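/- For every word w in W_*, the number of non-U letters occurring before the first U in w is 0, and the sequence (p_1, …, p_k) consists of k nonnegative integers whose sum is n. -/

import Mathlib

inductive Letter : Type
  | R | U | D
deriving DecidableEq

theorem List.splitOn_cons_eq_modifyHead {α : Type*} [DecidableEq α] (a x : α) (l : List α) :
    (x :: l).splitOn a =
      if x = a then [] :: l.splitOn a else (l.splitOn a).modifyHead (x :: ·) := by
  simp [List.splitOn, List.splitOnP_cons_eq_if_modifyHead]

theorem List.length_splitOn_eq_count_add_one {α : Type*} [DecidableEq α] (a : α) (l : List α) :
    (l.splitOn a).length = l.count a + 1 := by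
  induction l with
  | nil => simp
  | cons x l ih =>
    rw [List.splitOn_cons_eq_modifyHead]
    split_ifs with h <;> simp [h, ih]

theorem List.sum_map_length_splitOn_add_count {α : Type*} [DecidableEq α] (a : α) (l : List α) :
    ((l.splitOn a).map List.length).sum + l.count a = l.length := by
  induction l with
  | nil => simp
  | cons x l ih =>
    rw [List.splitOn_cons_eq_modifyHead]
    split_ifs with h
    · simp only [h, List.map_cons, List.sum_cons, List.length_nil, List.count_cons_self,
        List.length_cons]
      omega
    · have hne := List.length_splitOn_eq_count_add_one a l
      cases hs : l.splitOn a with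
      | nil => simp [hs] at hne
      | cons y ys =>
        simp only [hs, List.map_cons, List.sum_cons] at ih
        simp only [List.modifyHead_cons, List.map_cons, List.sum_cons, List.length_cons,
          List.count_cons_of_ne h]
        omega

theorem Letter.length_eq_count_add (l : List Letter) :
    l.length = l.count Letter.R + l.count Letter.U + l.count Letter.D := by
  induction l with
  | nil => simp
  | cons x l ih => cases x <;> simp [ih] <;> omega

open Letter in
/-- For `w ∈ W_*`, the number `p_0` of non-U letters before the first U is `0`, and
the sequence `(p_1, …, p_k)` consists of `k` nonnegative integers summing to `n`.
Here `((w.splitOn U).map List.length)` is the list `(p_0, p_1, …, p_k)`. -/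
theorem stmt_5 (n k : ℕ) (hk : 1 ≤ k) (hkn : k ≤ n) (w : List Letter)
    (hR : w.count R = k) (hU : w.count U = k) (hD : w.count D = n - k)
    (hhead : w.head? ≠ some D)
    (hstar : ∃ u v : List Letter, w = u ++ D :: v ∧ R ∉ u) :
    ((w.splitOn U).map List.length).head? = some 0 ∧
      ((w.splitOn U).map List.length).tail.length = k ∧
      ((w.splitOn U).map List.length).tail.sum = n := by
  obtain ⟨u, v, rfl, hRu⟩ := hstar
  cases u with
  | nil => simp at hhead
  | cons x t =>
    cases x with
    | R => simp at hRu
    | D => simp at hhead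
    | U =>
      have hlen := Letter.length_eq_count_add ((U :: t) ++ D :: v)
      rw [hR, hU, hD] at hlen
      rw [List.cons_append] at hU hlen ⊢
      rw [List.count_cons_self] at hU
      rw [List.length_cons] at hlen
      have hcount := List.length_splitOn_eq_count_add_one U (t ++ D :: v)
      have hsum := List.sum_map_length_splitOn_add_count U (t ++ D :: v)
      rw [List.splitOn_cons_eq_modifyHead, if_pos rfl]
      simp only [List.map_cons, List.length_nil, List.head?_cons, List.tail_cons, List.length_map,
        true_and]
      omega
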